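/- Let f ∈ 𝒢_λ. Then the conjugacy H_f converges on the open disk D_{r̃(λ)}(0), maps D_{r̃(λ)}(0) bijectively onto itself, and satisfies H_f(f(x)) = λ·H_f(x) for all x ∈ D_{r̃(λ)}(0); consequently the linearization disk Δ_f contains D_{r̃(λ)}(0). Moreover, if H_f converges on the closed disk of radius r̃(λ) about 0, then H_f maps that closed disk bijectively onto itself and Δ_f contains the closed disk of radius r̃(λ) about 0. -/

import Mathlib

open scoped BigOperators

noncomputable section

/-- `R(s) = p^{-1/(p^{s-1}(p-1))}` for `s ≥ 1`, and `R(0) = 0`. -/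
def Rr (p : ℕ) (s : ℕ) : ℝ :=
  if s = 0 then 0 else (p : ℝ) ^ (-(1 : ℝ) / ((p : ℝ) ^ (s - 1) * ((p : ℝ) - 1)))

/-- The group `Γ_r` of `p`-power roots of unity. -/
def GammaR (p : ℕ) (K : Type*) [Monoid K] : Set K := {z | ∃ k : ℕ, z ^ p ^ k = 1}

/-- The quantity `r̃(λ)`. -/
def rTilde {K : Type*} [NontriviallyNormedField K] (p : ℕ) (lam γ₀ : K) (m s t : ℕ) : ℝ :=
  Rr p (s + 1) ^ ((1 : ℝ) / m) *
    (p : ℝ) ^ (-(((s : ℝ) - (t : ℝ)) / ((m : ℝ) * (p : ℝ) ^ s))) *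
    ‖1 - lam ^ m‖ ^ ((s : ℝ) * ((p : ℝ) - 1) / ((m : ℝ) * (p : ℝ))) *
    ‖γ₀ - lam ^ m‖ ^ ((1 : ℝ) / ((m : ℝ) * (p : ℝ) ^ ((s : ℝ) - (t : ℝ))))

/-- Coefficient of `x^k` in the formal composition `H ∘ F`, where `H, F` are given by their
coefficient sequences `b, c` and `F` has zero constant term. -/
def compCoeff {K : Type*} [Field K] (b c : ℕ → K) (k : ℕ) : K :=
  ∑ l ∈ Finset.range (k + 1), b l * PowerSeries.coeff (R := K) k ((PowerSeries.mk c) ^ l)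

/-- `b` is (the coefficient sequence of) the normalized formal linearizing conjugacy `H_f` for the
power series `f` with coefficient sequence `c`: `H(0)=0`, `H'(0)=1` and `H ∘ f = λ·H` as formal
power series. -/
def IsConjugacy {K : Type*} [Field K] (lam : K) (c b : ℕ → K) : Prop :=
  b 0 = 0 ∧ b 1 = 1 ∧ ∀ k, compCoeff b c k = lam * b k

/-- Evaluation of the power series with coefficients `b` at `x`. -/
def pEval {K : Type*} [NontriviallyNormedField K] (b : ℕ → K) (x : K) : K :=
  ∑' k, b k * x ^ k

/-- `f` is analytically linearizable on `U` (a disk about `0`): `f` maps `U` to itself and some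
convergent power series `h` with `h(0)=0`, `h'(0)=1` maps `U` bijectively onto itself and
conjugates `f` to `x ↦ λx` on `U`. -/
def LinearizableOn {K : Type*} [NontriviallyNormedField K] (f : K → K) (lam : K)
    (U : Set K) : Prop :=
  Set.MapsTo f U U ∧
    ∃ b : ℕ → K, b 0 = 0 ∧ b 1 = 1 ∧
      (∀ x ∈ U, Summable fun k => b k * x ^ k) ∧
      Set.BijOn (pEval b) U U ∧
      ∀ x ∈ U, pEval b (f x) = lam * pEval b x

/-- A disk about `0`: an open or closed ball centered at the origin. -/
def IsZeroDisk {K : Type*} [NontriviallyNormedField K] (U : Set K) : Prop :=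
  ∃ ρ : ℝ, U = Metric.ball (0 : K) ρ ∨ U = Metric.closedBall (0 : K) ρ

/-- `x` is a periodic point of `f` of minimal period `q`. -/
def IsMinPeriodicPt {K : Type*} (f : K → K) (q : ℕ) (x : K) : Prop :=
  f^[q] x = x ∧ ∀ j, 1 ≤ j → j < q → f^[j] x ≠ x

/-- The valuation `ν(x) = -log_p |x|`. -/
def nuP {K : Type*} [NontriviallyNormedField K] (p : ℕ) (z : K) : ℝ :=
  -Real.logb p ‖z‖

/-- `κ_n = -(ν(1-λ^{p^n}) - ν(1-λ^{p^{n-1}}))/p^n`. -/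
def kappaN {K : Type*} [NontriviallyNormedField K] (p : ℕ) (lam : K) (n : ℕ) : ℝ :=
  -(nuP p (1 - lam ^ p ^ n) - nuP p (1 - lam ^ p ^ (n - 1))) / (p : ℝ) ^ n

open Classical in
/-- The multiplicity of `x` as a zero of the analytic function `g`. -/
def analyticMult {K : Type*} [NontriviallyNormedField K] (g : K → K) (x : K) : ℕ :=
  if h : AnalyticAt K g x then (analyticOrderAt g x).toNat else 0

end

section PowerSeriesEvaluation

open Filter Topology

variable {K : Type*} [NontriviallyNormedField K]

lemma pEval_zero {b : ℕ → K} (h0 : b 0 = 0) : pEval b 0 = 0 := by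
  have h : (fun k => b k * (0 : K) ^ k) = fun _ => 0 := by
    funext k
    rcases k with _ | k <;> simp [h0]
  rw [pEval, h, tsum_zero]

lemma coeff_mk_pow_eq_zero {c : ℕ → K} (hc0 : c 0 = 0) {l k : ℕ} (hkl : k < l) :
    PowerSeries.coeff k ((PowerSeries.mk c) ^ l) = 0 := by
  refine PowerSeries.coeff_of_lt_order _ (lt_of_lt_of_le (by exact_mod_cast hkl)
    (PowerSeries.le_order_pow_of_constantCoeff_eq_zero l ?_))
  simp [← PowerSeries.coeff_zero_eq_constantCoeff_apply, hc0]

lemma coeff_mk_pow_self {c : ℕ → K} (hc0 : c 0 = 0) (l : ℕ) :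
    PowerSeries.coeff l ((PowerSeries.mk c) ^ l) = c 1 ^ l := by
  have hX : PowerSeries.mk c = PowerSeries.X * PowerSeries.mk fun i => c (i + 1) := by
    ext n
    rcases n with _ | n <;> simp [hc0, PowerSeries.coeff_succ_X_mul]
  have h := PowerSeries.coeff_X_pow_mul ((PowerSeries.mk fun i => c (i + 1)) ^ l) l 0
  rw [zero_add] at h
  rw [hX, mul_pow, h, PowerSeries.coeff_zero_eq_constantCoeff_apply, map_pow,
    ← PowerSeries.coeff_zero_eq_constantCoeff_apply, PowerSeries.coeff_mk]

lemma summable_norm_mul_pow {d : ℕ → K} (hd : ∀ i, ‖d i‖ ≤ 1) {x : K} (hx : ‖x‖ < 1) :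
    Summable fun k => ‖d k * x ^ k‖ := by
  refine Summable.of_nonneg_of_le (fun _ => norm_nonneg _) (fun k => ?_)
    (summable_geometric_of_lt_one (norm_nonneg x) hx)
  rw [norm_mul, norm_pow]
  exact mul_le_of_le_one_left (by positivity) (hd k)

variable [IsUltrametricDist K]

lemma norm_sub_le_max_norm (x y : K) : ‖x - y‖ ≤ max ‖x‖ ‖y‖ := by
  simpa [sub_eq_add_neg] using IsUltrametricDist.norm_add_le_max x (-y)

lemma norm_pow_succ_sub_pow_succ_le {x y : K} {ρ : ℝ} (hx : ‖x‖ ≤ ρ) (hy : ‖y‖ ≤ ρ) (k : ℕ) :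
    ‖x ^ (k + 1) - y ^ (k + 1)‖ ≤ ρ ^ k * ‖x - y‖ := by
  have hρ : 0 ≤ ρ := (norm_nonneg x).trans hx
  rw [← (Commute.all x y).geom_sum₂_mul, norm_mul]
  gcongr
  refine IsUltrametricDist.norm_sum_le_of_forall_le_of_nonneg (by positivity) fun i hi => ?_
  have hik : i + (k + 1 - 1 - i) = k := by
    have := Finset.mem_range.1 hi
    omega
  calc ‖x ^ i * y ^ (k + 1 - 1 - i)‖ ≤ ρ ^ i * ρ ^ (k + 1 - 1 - i) := by
        rw [norm_mul, norm_pow, norm_pow]; gcongr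
    _ = ρ ^ k := by rw [← pow_add, hik]

lemma exists_forall_le_lt_one_of_tendsto_zero {f : ℕ → ℝ} (hf : Tendsto f atTop (𝓝 0))
    (h1 : ∀ k, f k < 1) : ∃ q, 0 ≤ q ∧ q < 1 ∧ ∀ k, f k ≤ q := by
  obtain ⟨q, hq, hmax⟩ := hf.isCompact_insert_range.exists_isGreatest (Set.insert_nonempty _ _)
  refine ⟨q, hmax (Set.mem_insert _ _), ?_, fun k => hmax (Set.mem_insert_of_mem _ ⟨k, rfl⟩)⟩
  rcases hq with rfl | ⟨k, rfl⟩
  exacts [one_pos, h1 k]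

lemma summable_mul_pow_of_norm_le [CompleteSpace K] {b : ℕ → K} {x y : K}
    (hx : Summable fun k => b k * x ^ k)
    (hyx : ‖y‖ ≤ ‖x‖) : Summable fun k => b k * y ^ k := by
  refine NonarchimedeanAddGroup.summable_of_tendsto_cofinite_zero
    (squeeze_zero_norm (fun k => ?_) (tendsto_zero_iff_norm_tendsto_zero.1
      hx.tendsto_cofinite_zero))
  rw [norm_mul, norm_mul, norm_pow, norm_pow]
  gcongr

/-- A power series tangent to the identity whose nonlinear terms are strictly dominated on a closed
disk differs from the identity by a contraction. -/
lemma exists_norm_pEval_sub_sub_le [CompleteSpace K] {b : ℕ → K} (h0 : b 0 = 0) (h1 : b 1 = 1)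
    {z : K} (hz : z ≠ 0)
    (hsum : Summable fun k => b k * z ^ k) (hlt : ∀ k, ‖b (k + 2)‖ * ‖z‖ ^ (k + 1) < 1) :
    ∃ q, 0 ≤ q ∧ q < 1 ∧ ∀ x y : K, ‖x‖ ≤ ‖z‖ → ‖y‖ ≤ ‖z‖ →
      ‖pEval b x - pEval b y - (x - y)‖ ≤ q * ‖x - y‖ := by
  have hz' : 0 < ‖z‖ := norm_pos_iff.2 hz
  have hlim : Tendsto (fun k => ‖b (k + 2)‖ * ‖z‖ ^ (k + 1)) atTop (𝓝 0) := by
    have := ((tendsto_add_atTop_iff_nat 2).2 hsum.tendsto_atTop_zero).norm.mul_const ‖z‖⁻¹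
    simp only [norm_zero, zero_mul] at this
    refine this.congr fun k => ?_
    rw [norm_mul, norm_pow, pow_succ _ (k + 1), ← mul_assoc, mul_inv_cancel_right₀ hz'.ne']
  obtain ⟨q, hq0, hq1, hq⟩ := exists_forall_le_lt_one_of_tendsto_zero hlim hlt
  refine ⟨q, hq0, hq1, fun x y hx hy => ?_⟩
  have hs := ((summable_mul_pow_of_norm_le hsum hx).hasSum.sub
    (summable_mul_pow_of_norm_le hsum hy).hasSum).sub (hasSum_ite_eq 1 (x - y))
  rw [pEval, pEval, ← hs.tsum_eq]
  refine IsUltrametricDist.norm_tsum_le_of_forall_le_of_nonneg (by positivity) fun k => ?_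
  match k with
  | 0 => simp [h0]; positivity
  | 1 => simp [h1]; positivity
  | k + 2 =>
    rw [← mul_sub, if_neg (by simp), sub_zero, norm_mul]
    calc ‖b (k + 2)‖ * ‖x ^ (k + 2) - y ^ (k + 2)‖
        ≤ ‖b (k + 2)‖ * (‖z‖ ^ (k + 1) * ‖x - y‖) := by
          gcongr; exact norm_pow_succ_sub_pow_succ_le hx hy (k + 1)
      _ = ‖b (k + 2)‖ * ‖z‖ ^ (k + 1) * ‖x - y‖ := by ring
      _ ≤ q * ‖x - y‖ := by gcongr; exact hq k

lemma norm_eq_of_norm_sub_le {u v : K} {q : ℝ} (hq1 : q < 1) (h : ‖u - v‖ ≤ q * ‖v‖) :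
    ‖u‖ = ‖v‖ := by
  rcases eq_or_ne v 0 with rfl | hv
  · simpa using h
  have hlt : ‖u - v‖ < ‖v‖ := h.trans_lt (by
    have := norm_pos_iff.2 hv
    nlinarith)
  have := IsUltrametricDist.norm_add_eq_max_of_norm_ne_norm hlt.ne
  rwa [sub_add_cancel, max_eq_right hlt.le] at this

/-- Inverse function theorem on closed disks. -/
lemma bijOn_pEval_closedBall [CompleteSpace K] {b : ℕ → K} (h0 : b 0 = 0) (h1 : b 1 = 1)
    {z : K} (hz : z ≠ 0)
    (hsum : Summable fun k => b k * z ^ k) (hlt : ∀ k, ‖b (k + 2)‖ * ‖z‖ ^ (k + 1) < 1) :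
    Set.BijOn (pEval b) (Metric.closedBall 0 ‖z‖) (Metric.closedBall 0 ‖z‖) ∧
      ∀ x, ‖x‖ ≤ ‖z‖ → ‖pEval b x‖ = ‖x‖ := by
  obtain ⟨q, hq0, hq1, hq⟩ := exists_norm_pEval_sub_sub_le h0 h1 hz hsum hlt
  have hnorm : ∀ x, ‖x‖ ≤ ‖z‖ → ‖pEval b x‖ = ‖x‖ := fun x hx =>
    norm_eq_of_norm_sub_le hq1 (by simpa [pEval_zero h0] using hq x 0 hx (by simp))
  refine ⟨⟨fun x hx => ?_, fun x hx y hy hxy => ?_, fun y hy => ?_⟩, hnorm⟩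
  · rw [mem_closedBall_zero_iff] at *
    rwa [hnorm x hx]
  · rw [mem_closedBall_zero_iff] at hx hy
    have := norm_eq_of_norm_sub_le hq1 (hq x y hx hy)
    rw [hxy, sub_self, norm_zero] at this
    exact sub_eq_zero.1 (norm_eq_zero.1 this.symm)
  · rw [mem_closedBall_zero_iff] at hy
    let g : K → K := fun x => y - (pEval b x - x)
    have hg : Set.MapsTo g (Metric.closedBall 0 ‖z‖) (Metric.closedBall 0 ‖z‖) := fun x hx => by
      rw [mem_closedBall_zero_iff] at *
      have hle : ‖pEval b x - x‖ ≤ ‖z‖ :=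
        (norm_sub_le_max_norm (pEval b x) x).trans (max_le ((hnorm x hx).trans_le hx) hx)
      exact (norm_sub_le_max_norm y _).trans (max_le hy hle)
    have hc : ContractingWith ⟨q, hq0⟩ (hg.restrict g _ _) := by
      refine ⟨by exact_mod_cast hq1, LipschitzWith.of_dist_le_mul fun x x' => ?_⟩
      have hx := mem_closedBall_zero_iff.1 x.2
      have hx' := mem_closedBall_zero_iff.1 x'.2
      rw [Subtype.dist_eq, Subtype.dist_eq, dist_eq_norm, dist_eq_norm]
      refine Eq.trans_le ?_ (hq x x' hx hx')
      rw [← norm_neg]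
      congr 1
      simp only [Set.MapsTo.val_restrict_apply, g]
      ring
    obtain ⟨x, hx, hfix, -⟩ := hc.exists_fixedPoint' Metric.isClosed_closedBall.isComplete hg
      (x := 0) (by simp) (edist_ne_top _ _)
    refine ⟨x, hx, ?_⟩
    have : y - (pEval b x - x) = x := hfix
    linear_combination -this

/-- Inverse function theorem on a union of closed disks about the origin. -/
lemma bijOn_pEval [CompleteSpace K] {b : ℕ → K} (h0 : b 0 = 0) (h1 : b 1 = 1) {U : Set K}
    (hU : ∀ x ∈ U, ∀ y, ‖y‖ ≤ ‖x‖ → y ∈ U)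
    (hsum : ∀ x ∈ U, Summable fun k => b k * x ^ k)
    (hlt : ∀ x ∈ U, ∀ k, ‖b (k + 2)‖ * ‖x‖ ^ (k + 1) < 1) :
    Set.BijOn (pEval b) U U := by
  have key : ∀ z ∈ U, z ≠ 0 → _ := fun z hz hz0 =>
    bijOn_pEval_closedBall h0 h1 hz0 (hsum z hz) (hlt z hz)
  refine ⟨fun x hx => ?_, fun x hx y hy hxy => ?_, fun y hy => ?_⟩
  · rcases eq_or_ne x 0 with rfl | hx0
    · rwa [pEval_zero h0]
    · exact hU x hx _ ((key x hx hx0).2 x le_rfl).le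
  · wlog hle : ‖y‖ ≤ ‖x‖ generalizing x y
    · exact (this y hy x hx hxy.symm (le_of_not_ge hle)).symm
    rcases eq_or_ne x 0 with rfl | hx0
    · exact (norm_le_zero_iff.1 (by simpa using hle)).symm
    · exact (key x hx hx0).1.injOn (by simp) (by simpa using hle) hxy
  · rcases eq_or_ne y 0 with rfl | hy0
    · exact ⟨0, hy, pEval_zero h0⟩
    · obtain ⟨x, hx, hxy⟩ := (key y hy hy0).1.surjOn (by simp : y ∈ Metric.closedBall 0 ‖y‖)
      exact ⟨x, hU y hy x (by simpa using hx), hxy⟩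

lemma norm_pEval_le {c : ℕ → K} (hc0 : c 0 = 0) (hc : ∀ i, ‖c i‖ ≤ 1) {x : K} (hx : ‖x‖ ≤ 1) :
    ‖pEval c x‖ ≤ ‖x‖ := by
  refine IsUltrametricDist.norm_tsum_le_of_forall_le_of_nonneg (norm_nonneg x) fun k => ?_
  rcases k with _ | k
  · simp [hc0]
  · rw [norm_mul, norm_pow, pow_succ]
    calc ‖c (k + 1)‖ * (‖x‖ ^ k * ‖x‖) ≤ 1 * (1 * ‖x‖) := by
          gcongr
          exacts [hc _, pow_le_one₀ (norm_nonneg x) hx]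
      _ = ‖x‖ := by ring

lemma norm_coeff_pow_le_one {c : ℕ → K} (hc : ∀ i, ‖c i‖ ≤ 1) (l k : ℕ) :
    ‖PowerSeries.coeff k ((PowerSeries.mk c) ^ l)‖ ≤ 1 := by
  induction l generalizing k with
  | zero => rw [pow_zero, PowerSeries.coeff_one]; split_ifs <;> simp
  | succ l ih =>
    rw [pow_succ, PowerSeries.coeff_mul]
    refine IsUltrametricDist.norm_sum_le_of_forall_le_of_nonneg zero_le_one fun i _ => ?_
    rw [norm_mul, PowerSeries.coeff_mk]
    exact mul_le_one₀ (ih _) (norm_nonneg _) (hc _)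

lemma pEval_pow [CompleteSpace K] {c : ℕ → K} (hc : ∀ i, ‖c i‖ ≤ 1) {x : K} (hx : ‖x‖ < 1)
    (l : ℕ) :
    pEval c x ^ l = ∑' k, PowerSeries.coeff k ((PowerSeries.mk c) ^ l) * x ^ k := by
  induction l with
  | zero =>
    rw [tsum_eq_single 0 (fun k hk => by simp [PowerSeries.coeff_one, hk])]
    simp
  | succ l ih =>
    rw [pow_succ, ih, pEval, tsum_mul_tsum_eq_tsum_sum_antidiagonal_of_summable_norm
      (summable_norm_mul_pow (norm_coeff_pow_le_one hc l) hx) (summable_norm_mul_pow hc hx)]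
    refine tsum_congr fun k => ?_
    rw [pow_succ, PowerSeries.coeff_mul, Finset.sum_mul]
    refine Finset.sum_congr rfl fun i hi => ?_
    rw [PowerSeries.coeff_mk, ← Finset.HasAntidiagonal.mem_antidiagonal.1 hi, pow_add]
    ring

/-- The formal conjugacy equation holds pointwise wherever the conjugacy converges. -/
lemma pEval_pEval_of_isConjugacy [CompleteSpace K] {lam : K} {c b : ℕ → K} (hc0 : c 0 = 0)
    (hc : ∀ i, ‖c i‖ ≤ 1) (hb : IsConjugacy lam c b) {x : K} (hx : ‖x‖ < 1)
    (hsum : Summable fun k => b k * x ^ k) :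
    pEval b (pEval c x) = lam * pEval b x := by
  let F : ℕ → ℕ → K := fun l k => b l * PowerSeries.coeff k ((PowerSeries.mk c) ^ l) * x ^ k
  have hF : Summable (Function.uncurry F) := by
    refine NonarchimedeanAddGroup.summable_of_tendsto_cofinite_zero ?_
    have hlim := hsum.tendsto_atTop_zero.norm
    rw [norm_zero] at hlim
    obtain ⟨C, hC⟩ := hlim.bddAbove_range
    have hCb : ∀ l, ‖b l‖ * ‖x‖ ^ l ≤ C := fun l => by
      simpa using hC (Set.mem_range_self l)
    have hC0 : 0 ≤ C := (by positivity : 0 ≤ ‖b 0‖ * ‖x‖ ^ 0).trans (hCb 0)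
    rw [Metric.tendsto_nhds]
    intro ε hε
    obtain ⟨N, hN⟩ := eventually_atTop.1 (hlim.eventually_lt_const hε)
    have hgeom := (tendsto_pow_atTop_nhds_zero_of_lt_one (norm_nonneg x) hx).const_mul C
    rw [mul_zero] at hgeom
    obtain ⟨J, hJ⟩ := eventually_atTop.1 (hgeom.eventually_lt_const hε)
    rw [eventually_cofinite]
    refine (((Finset.range N) ×ˢ (Finset.range (N + J))).finite_toSet).subset ?_
    rintro ⟨l, k⟩ hlk
    simp only [Set.mem_ofPred_eq, dist_zero_right, not_lt, Function.uncurry, F] at hlk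
    by_contra hnot
    have hnot' : N ≤ l ∨ N + J ≤ k := by
      by_contra! hlt
      exact hnot (by simpa using hlt)
    rcases lt_or_ge k l with hkl | hkl
    · rw [coeff_mk_pow_eq_zero hc0 hkl] at hlk
      simp at hlk
      exact absurd hlk hε.not_ge
    obtain ⟨j, rfl⟩ := Nat.exists_eq_add_of_le hkl
    have hle : ‖b l * PowerSeries.coeff (l + j) ((PowerSeries.mk c) ^ l) * x ^ (l + j)‖
        ≤ ‖b l‖ * ‖x‖ ^ l * ‖x‖ ^ j := by
      rw [norm_mul, norm_mul, norm_pow, pow_add, ← mul_assoc]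
      gcongr
      exact mul_le_of_le_one_right (norm_nonneg _) (norm_coeff_pow_le_one hc _ _)
    rcases le_or_gt N l with hl | hl
    · have h1 := hN l hl
      rw [norm_mul, norm_pow] at h1
      have h2 : ‖b l‖ * ‖x‖ ^ l * ‖x‖ ^ j ≤ ‖b l‖ * ‖x‖ ^ l :=
        mul_le_of_le_one_right (by positivity) (pow_le_one₀ (norm_nonneg x) hx.le)
      linarith
    · have h1 := hJ j (by omega)
      have h2 : ‖b l‖ * ‖x‖ ^ l * ‖x‖ ^ j ≤ C * ‖x‖ ^ j := by gcongr; exact hCb l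
      linarith
  calc pEval b (pEval c x) = ∑' l, ∑' k, F l k := by
        refine tsum_congr fun l => ?_
        rw [pEval_pow hc hx, ← tsum_mul_left]
        exact tsum_congr fun k => by simp only [F]; ring
    _ = ∑' k, ∑' l, F l k := (Summable.tsum_comm hF).symm
    _ = ∑' k, lam * (b k * x ^ k) := by
        refine tsum_congr fun k => ?_
        rw [tsum_eq_sum (s := Finset.range (k + 1)) fun l hl => by
          simp only [F]
          rw [coeff_mk_pow_eq_zero hc0 (by simpa using hl)]; simp]
        rw [← mul_assoc, ← hb.2.2 k, compCoeff, Finset.sum_mul]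
    _ = lam * pEval b x := tsum_mul_left

/-- The recursion for the coefficients of the conjugacy bounds them by the small divisors. -/
lemma norm_conjugacy_coeff_mul_prod_le_one {lam : K} (hlam : ‖lam‖ = 1)
    (hroot : ∀ n : ℕ, 1 ≤ n → lam ^ n ≠ 1) {c b : ℕ → K} (hc0 : c 0 = 0) (hc1 : c 1 = lam)
    (hc : ∀ i, ‖c i‖ ≤ 1) (hb : IsConjugacy lam c b) (k : ℕ) :
    ‖b (k + 1)‖ * ∏ n ∈ Finset.range k, ‖1 - lam ^ (n + 1)‖ ≤ 1 := by
  have hle : ∀ n : ℕ, ‖1 - lam ^ n‖ ≤ 1 := fun n =>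
    (norm_sub_le_max_norm 1 _).trans (by simp [hlam])
  induction k using Nat.strong_induction_on with
  | _ k ih =>
  rcases k with _ | k
  · simp [hb.2.1]
  have hrec : b (k + 2) * (lam * (1 - lam ^ (k + 1))) = ∑ l ∈ Finset.range (k + 2),
      b l * PowerSeries.coeff (k + 2) ((PowerSeries.mk c) ^ l) := by
    have := hb.2.2 (k + 2)
    rw [compCoeff, Finset.sum_range_succ, coeff_mk_pow_self hc0, hc1] at this
    linear_combination -this
  have hnorm : ‖b (k + 2)‖ * ‖1 - lam ^ (k + 1)‖ = ‖b (k + 2) * (lam * (1 - lam ^ (k + 1)))‖ := by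
    rw [norm_mul, norm_mul, hlam, one_mul]
  have hP : 0 < ∏ n ∈ Finset.range k, ‖1 - lam ^ (n + 1)‖ :=
    Finset.prod_pos fun n _ => norm_pos_iff.2 (sub_ne_zero.2 (hroot _ (by omega)).symm)
  rw [Finset.prod_range_succ, mul_comm (∏ n ∈ _, _), ← mul_assoc, hnorm, hrec,
    ← le_div_iff₀ hP]
  refine IsUltrametricDist.norm_sum_le_of_forall_le_of_nonneg (by positivity) fun l hl => ?_
  rw [norm_mul]
  refine (mul_le_of_le_one_right (norm_nonneg _) (norm_coeff_pow_le_one hc _ _)).trans ?_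
  rcases l with _ | l
  · rw [hb.1, norm_zero]; positivity
  rw [le_div_iff₀ hP]
  have hlk : l ≤ k := by have := Finset.mem_range.1 hl; omega
  refine le_trans ?_ (ih l (by omega))
  gcongr ‖b (l + 1)‖ * ?_
  exact Finset.prod_le_prod_of_subset_of_le_one (Finset.range_mono hlk)
    (fun n _ => norm_nonneg _) fun n _ _ => hle _

end PowerSeriesEvaluation

section Radii

variable {p : ℕ}

lemma Rr_zero : Rr p 0 = 0 := by simp [Rr]

lemma Rr_succ (s : ℕ) : Rr p (s + 1) = (p : ℝ) ^ (-(1 : ℝ) / ((p : ℝ) ^ s * ((p : ℝ) - 1))) := by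
  simp [Rr]

lemma Rr_succ_pos (hp : 1 < p) (s : ℕ) : 0 < Rr p (s + 1) := by
  have hp' : (1 : ℝ) < p := by exact_mod_cast hp
  rw [Rr_succ]
  exact Real.rpow_pos_of_pos (by linarith) _

lemma Rr_strictMono (hp : 1 < p) : StrictMono (Rr p) := by
  have hp' : (1 : ℝ) < p := by exact_mod_cast hp
  refine strictMono_nat_of_lt_succ fun s => ?_
  rcases s with _ | s
  · rw [Rr_zero]; exact Rr_succ_pos hp 0
  rw [Rr_succ, Rr_succ]
  refine Real.rpow_lt_rpow_of_exponent_lt hp' ?_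
  have h1 : 0 < (p : ℝ) - 1 := by linarith
  rw [neg_div, neg_div, neg_lt_neg_iff]
  refine one_div_lt_one_div_of_lt (by positivity) ?_
  gcongr
  exact Nat.lt_succ_self s

lemma Rr_lt_one (hp : 1 < p) (s : ℕ) : Rr p s < 1 := by
  have hp' : (1 : ℝ) < p := by exact_mod_cast hp
  rcases s with _ | s
  · simp [Rr_zero]
  rw [Rr_succ]
  have h1 : 0 < (p : ℝ) - 1 := by linarith
  exact Real.rpow_lt_one_of_one_lt_of_neg hp' (div_neg_of_neg_of_pos (by norm_num) (by positivity))

lemma Rr_pow (hp : 1 < p) (s : ℕ) : Rr p (s + 2) ^ p = Rr p (s + 1) := by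
  have hp' : (1 : ℝ) < p := by exact_mod_cast hp
  have h1 : (p : ℝ) - 1 ≠ 0 := by linarith
  have h0 : (p : ℝ) ≠ 0 := by linarith
  rw [Rr_succ, Rr_succ, ← Real.rpow_natCast, ← Real.rpow_mul (by linarith)]
  congr 1
  field_simp
  ring

lemma Rr_one_pow (hp : 1 < p) : Rr p 1 ^ (p - 1) = (p : ℝ)⁻¹ := by
  have hp' : (1 : ℝ) < p := by exact_mod_cast hp
  have h1 : (p : ℝ) - 1 ≠ 0 := by linarith
  rw [Rr_succ, ← Real.rpow_natCast, ← Real.rpow_mul (by linarith), Nat.cast_sub hp.le,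
    ← Real.rpow_neg_one]
  congr 1
  field_simp
  simp

lemma inv_le_Rr_one (hp : 1 < p) : (p : ℝ)⁻¹ ≤ Rr p 1 := by
  rw [← Rr_one_pow hp]
  exact pow_le_of_le_one (Rr_succ_pos hp 0).le (Rr_lt_one hp 1).le (by omega)

end Radii

section SmallDivisors

open Polynomial

variable {p : ℕ} {K : Type*} [NontriviallyNormedField K]

lemma prod_one_sub_sdiff_nthRoots [IsAlgClosed K] [CharZero K] [DecidableEq K] (hp : p.Prime)
    {t a : ℕ} (hta : t ≤ a) :
    ∏ γ ∈ nthRootsFinset (p ^ a) (1 : K) \ nthRootsFinset (p ^ t) (1 : K), (1 - γ)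
      = (p : K) ^ (a - t) := by
  have hpos : ∀ n, 0 < p ^ n := fun n => pow_pos hp.pos n
  have hfac : ∀ n, (X ^ p ^ n - 1 : K[X]) = ∏ γ ∈ nthRootsFinset (p ^ n) (1 : K), (X - C γ) :=
    fun n => by
      have : NeZero ((p ^ n : ℕ) : K) := ⟨by exact_mod_cast (hpos n).ne'⟩
      obtain ⟨ζ, hζ⟩ := HasEnoughRootsOfUnity.exists_primitiveRoot K (p ^ n)
      exact X_pow_sub_one_eq_prod (hpos n) hζ
  have hsub : nthRootsFinset (p ^ t) (1 : K) ⊆ nthRootsFinset (p ^ a) (1 : K) := fun γ hγ => by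
    rw [mem_nthRootsFinset (hpos _)] at *
    rw [← Nat.add_sub_cancel' hta, pow_add, pow_mul, hγ, one_pow]
  have h1 : (∏ γ ∈ nthRootsFinset (p ^ a) (1 : K) \ nthRootsFinset (p ^ t) (1 : K), (X - C γ))
      = ∑ i ∈ Finset.range (p ^ (a - t)), (X ^ p ^ t : K[X]) ^ i := by
    have hne : (X ^ p ^ t - 1 : K[X]) ≠ 0 := X_pow_sub_C_ne_zero (hpos t) 1
    refine mul_right_cancel₀ hne ?_
    rw [geom_sum_mul, ← pow_mul, ← pow_add, Nat.add_sub_cancel' hta, hfac t, hfac a,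
      Finset.prod_sdiff hsub]
  have h2 := congrArg (eval 1) h1
  simpa [eval_prod, eval_finsetSum] using h2

variable [IsUltrametricDist K]

lemma norm_aeval_int_le_one (w : ℤ[X]) {e : K} (he : ‖e‖ ≤ 1) : ‖aeval e w‖ ≤ 1 := by
  rw [aeval_eq_sum_range]
  refine IsUltrametricDist.norm_sum_le_of_forall_le_of_nonneg zero_le_one fun i _ => ?_
  rw [zsmul_eq_mul, norm_mul, norm_pow]
  exact mul_le_one₀ (IsUltrametricDist.norm_intCast_le_one K _) (by positivity)
    (pow_le_one₀ (norm_nonneg e) he)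

lemma exists_one_add_pow_prime_eq (hp : p.Prime) {e : K} (he : ‖e‖ ≤ 1) :
    ∃ w : K, ‖w‖ ≤ 1 ∧ (1 + e) ^ p = 1 + e ^ p + p * e * (1 + e * w) := by
  obtain ⟨r, hr⟩ := exists_add_pow_prime_eq hp (1 : ℤ[X]) X
  have hr0 : r.coeff 0 = 1 := by
    have h := congrArg (fun f : ℤ[X] => f.coeff 1) hr
    have hp1 : (1 : ℕ) ≠ p := hp.one_lt.ne
    simp only [one_pow, mul_one, coeff_add, coeff_one_add_X_pow, Nat.choose_one_right,
      coeff_one, coeff_X_pow, if_neg hp1] at h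
    rw [mul_assoc, ← map_natCast C, coeff_C_mul, coeff_X_mul] at h
    have hp0 : (p : ℤ) ≠ 0 := by exact_mod_cast hp.ne_zero
    have : (p : ℤ) * r.coeff 0 = p * 1 := by simpa using h.symm
    exact mul_left_cancel₀ hp0 this
  obtain ⟨w, hw⟩ : X ∣ r - 1 := by
    rw [X_dvd_iff]; simp [hr0]
  refine ⟨aeval e w, norm_aeval_int_le_one w he, ?_⟩
  rw [sub_eq_iff_eq_add] at hw
  rw [hw] at hr
  have := congrArg (aeval e) hr
  simp only [map_pow, map_add, map_one, map_mul, map_natCast, aeval_X] at this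
  rw [this]
  ring

lemma norm_one_sub_pow_prime_le (hp : p.Prime) (hpK : ‖(p : K)‖ = (p : ℝ)⁻¹) {x : K}
    (hx : ‖1 - x‖ ≤ 1) : ‖1 - x ^ p‖ ≤ max (‖1 - x‖ ^ p) ((p : ℝ)⁻¹ * ‖1 - x‖) := by
  rw [norm_sub_rev 1 x] at *
  obtain ⟨w, hw, h⟩ := exists_one_add_pow_prime_eq hp hx
  rw [add_sub_cancel] at h
  have h1 : ‖1 + (x - 1) * w‖ ≤ 1 := (IsUltrametricDist.norm_add_le_max _ _).trans (by
    rw [norm_one, norm_mul]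
    exact max_le le_rfl (mul_le_one₀ hx (norm_nonneg _) hw))
  have h2 : x ^ p - 1 = (x - 1) ^ p + p * (x - 1) * (1 + (x - 1) * w) := by rw [h]; ring
  rw [norm_sub_rev, h2]
  refine (IsUltrametricDist.norm_add_le_max _ _).trans (max_le_max (norm_pow _ _).le ?_)
  rw [norm_mul, norm_mul, hpK]
  exact mul_le_of_le_one_right (by positivity) h1

lemma norm_one_sub_pow_prime_eq (hp : p.Prime) (hpK : ‖(p : K)‖ = (p : ℝ)⁻¹) {x : K}
    (hx : ‖1 - x‖ ≤ 1) (hR : Rr p 1 < ‖1 - x‖) : ‖1 - x ^ p‖ = ‖1 - x‖ ^ p := by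
  have hx0 : 0 < ‖1 - x‖ := (Rr_succ_pos hp.one_lt 0).trans hR
  have hlt : (p : ℝ)⁻¹ * ‖1 - x‖ < ‖1 - x‖ ^ p := by
    rw [← Rr_one_pow hp.one_lt, ← pow_sub_one_mul hp.ne_zero]
    gcongr
    · exact (Rr_succ_pos hp.one_lt 0).le
    · have := hp.two_le; omega
  rw [norm_sub_rev 1 x] at *
  obtain ⟨w, hw, h⟩ := exists_one_add_pow_prime_eq hp hx
  rw [add_sub_cancel] at h
  have h1 : ‖1 + (x - 1) * w‖ ≤ 1 := (IsUltrametricDist.norm_add_le_max _ _).trans (by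
    rw [norm_one, norm_mul]
    exact max_le le_rfl (mul_le_one₀ hx (norm_nonneg _) hw))
  have h2 : x ^ p - 1 = (x - 1) ^ p + p * (x - 1) * (1 + (x - 1) * w) := by rw [h]; ring
  have h3 : ‖(p : K) * (x - 1) * (1 + (x - 1) * w)‖ < ‖(x - 1) ^ p‖ := by
    rw [norm_pow, norm_mul, norm_mul, hpK]
    exact (mul_le_of_le_one_right (by positivity) h1).trans_lt hlt
  rw [norm_sub_rev, h2, IsUltrametricDist.norm_add_eq_max_of_norm_ne_norm h3.ne',
    max_eq_left h3.le, norm_pow]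

lemma eq_one_of_pow_prime_eq_one (hp : p.Prime) (hpK : ‖(p : K)‖ = (p : ℝ)⁻¹) {x : K}
    (hR : ‖1 - x‖ < Rr p 1) (hxp : x ^ p = 1) : x = 1 := by
  by_contra hne
  have hx1 : ‖1 - x‖ < 1 := hR.trans (Rr_lt_one hp.one_lt 1)
  have hx0 : 0 < ‖1 - x‖ := norm_pos_iff.2 (sub_ne_zero.2 (Ne.symm hne))
  have hlt : ‖1 - x‖ ^ p < (p : ℝ)⁻¹ * ‖1 - x‖ := by
    rw [← Rr_one_pow hp.one_lt, ← pow_sub_one_mul hp.ne_zero]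
    gcongr
    have := hp.two_le; omega
  rw [norm_sub_rev 1 x] at *
  obtain ⟨w, hw, h⟩ := exists_one_add_pow_prime_eq hp hx1.le
  rw [add_sub_cancel, hxp] at h
  have h1 : ‖1 + (x - 1) * w‖ = 1 := by
    have hlt : ‖(x - 1) * w‖ < ‖(1 : K)‖ := by
      rw [norm_one, norm_mul]
      exact (mul_le_of_le_one_right (norm_nonneg _) hw).trans_lt hx1
    rw [IsUltrametricDist.norm_add_eq_max_of_norm_ne_norm hlt.ne', max_eq_left hlt.le, norm_one]
  have h2 : (x - 1) ^ p = -(p * (x - 1) * (1 + (x - 1) * w)) := by linear_combination -h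
  have h3 := congrArg norm h2
  rw [norm_neg, norm_mul, norm_mul, h1, hpK, norm_pow, mul_one] at h3
  exact hlt.ne h3

lemma eq_one_of_pow_prime_pow_eq_one (hp : p.Prime) (hpK : ‖(p : K)‖ = (p : ℝ)⁻¹) (k : ℕ) {x : K}
    (hR : ‖1 - x‖ < Rr p 1) (hxp : x ^ p ^ k = 1) : x = 1 := by
  induction k generalizing x with
  | zero => simpa using hxp
  | succ k ih =>
    have hx1 : ‖1 - x‖ ≤ 1 := hR.le.trans (Rr_lt_one hp.one_lt 1).le
    have hinv : (p : ℝ)⁻¹ ≤ 1 := inv_le_one_of_one_le₀ (by exact_mod_cast hp.one_le)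
    refine eq_one_of_pow_prime_eq_one hp hpK hR (ih ?_ (by rw [← pow_mul, ← pow_succ', hxp]))
    refine (norm_one_sub_pow_prime_le hp hpK hx1).trans_lt (lt_of_le_of_lt (max_le ?_ ?_) hR)
    · exact pow_le_of_le_one (norm_nonneg _) hx1 hp.ne_zero
    · exact mul_le_of_le_one_left (norm_nonneg _) hinv

/-- The `p`-power roots of unity within distance less than `R(s + 1)` of `1` have order dividing
`p ^ s`. -/
lemma pow_eq_one_of_norm_lt_Rr (hp : p.Prime) (hpK : ‖(p : K)‖ = (p : ℝ)⁻¹) (s : ℕ) {x : K}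
    (hR : ‖1 - x‖ < Rr p (s + 1)) (hx : x ∈ GammaR p K) : x ^ p ^ s = 1 := by
  induction s generalizing x with
  | zero =>
    obtain ⟨k, hk⟩ := hx
    simpa using eq_one_of_pow_prime_pow_eq_one hp hpK k hR hk
  | succ s ih =>
    obtain ⟨k, hk⟩ := hx
    have hx1 : ‖1 - x‖ < 1 := hR.trans (Rr_lt_one hp.one_lt _)
    have hmono := (Rr_strictMono hp.one_lt).monotone (Nat.succ_le_succ (Nat.zero_le s))
    have hpos : (0 : ℝ) < (p : ℝ)⁻¹ := inv_pos.2 (by exact_mod_cast hp.pos)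
    rw [pow_succ', pow_mul]
    refine ih ?_ ⟨k, by rw [← pow_mul, mul_comm, pow_mul, hk, one_pow]⟩
    refine (norm_one_sub_pow_prime_le hp hpK hx1.le).trans_lt (max_lt ?_ ?_)
    · rw [← Rr_pow hp.one_lt]
      exact pow_lt_pow_left₀ hR (norm_nonneg _) hp.ne_zero
    · calc (p : ℝ)⁻¹ * ‖1 - x‖ < (p : ℝ)⁻¹ * 1 := by gcongr
        _ ≤ Rr p (s + 1) := by rw [mul_one]; exact (inv_le_Rr_one hp.one_lt).trans hmono

lemma norm_one_sub_pow_prime_pow_eq (hp : p.Prime) (hpK : ‖(p : K)‖ = (p : ℝ)⁻¹) {x : K}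
    (hx : ‖1 - x‖ < 1) (a s : ℕ) (hs : Rr p s ≤ ‖1 - x‖) (ha : a < s) :
    ‖1 - x ^ p ^ a‖ = ‖1 - x‖ ^ p ^ a := by
  have hRpow : ∀ i j : ℕ, Rr p (i + j + 1) ^ p ^ i = Rr p (j + 1) := fun i j => by
    induction i with
    | zero => simp
    | succ i ih =>
      rw [pow_succ', pow_mul, show i + 1 + j + 1 = i + j + 2 by ring, Rr_pow hp.one_lt, ih]
  induction a with
  | zero => simp
  | succ a ih =>
    have iha := ih (by omega)
    obtain ⟨j, rfl⟩ : ∃ j, s = a + (j + 1) + 1 := ⟨s - a - 2, by omega⟩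
    rw [pow_succ, pow_mul, norm_one_sub_pow_prime_eq hp hpK, iha, ← pow_mul]
    · rw [iha]; exact pow_le_one₀ (norm_nonneg _) hx.le
    · rw [iha]
      calc Rr p 1 < Rr p (j + 1 + 1) := Rr_strictMono hp.one_lt (by omega)
        _ = Rr p (a + (j + 1) + 1) ^ p ^ a := (hRpow a (j + 1)).symm
        _ ≤ ‖1 - x‖ ^ p ^ a := by
          gcongr
          exact (Rr_succ_pos hp.one_lt _).le

lemma norm_one_sub_le_norm_one_sub_pow (hcop : ∀ u : ℕ, p.Coprime u → ‖(u : K)‖ = 1)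
    {x : K} (hx : ‖1 - x‖ < 1) {u : ℕ} (hu : p.Coprime u) : ‖1 - x‖ ≤ ‖1 - x ^ u‖ := by
  have hx1 : ‖x‖ ≤ 1 := by
    have := norm_sub_le_max_norm 1 (1 - x)
    rw [sub_sub_cancel, norm_one] at this
    exact this.trans (max_le le_rfl hx.le)
  have hdiff : ‖∑ i ∈ Finset.range u, x ^ i - (u : K)‖ ≤ ‖1 - x‖ := by
    have : ∑ i ∈ Finset.range u, x ^ i - (u : K) = ∑ i ∈ Finset.range u, (x ^ i - 1) := by
      simp [Finset.sum_sub_distrib]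
    rw [this]
    refine IsUltrametricDist.norm_sum_le_of_forall_le_of_nonneg (norm_nonneg _) fun i _ => ?_
    rcases i with _ | i
    · simp
    · have := norm_pow_succ_sub_pow_succ_le hx1 norm_one.le i
      rwa [one_pow, one_pow, one_mul, norm_sub_rev x 1] at this
  have hsum : ‖∑ i ∈ Finset.range u, x ^ i‖ = 1 := by
    rw [← hcop u hu] at hx ⊢
    have hlt := hdiff.trans_lt hx
    have := IsUltrametricDist.norm_add_eq_max_of_norm_ne_norm hlt.ne
    rwa [sub_add_cancel, max_eq_right hlt.le] at this
  rw [← mul_neg_geom_sum, norm_mul, hsum, mul_one]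

/-- Lower bound for `|1 - μ ^ (p ^ a)|` in terms of the distance of `μ` to the nearest `p`-power
root of unity. -/
lemma le_norm_one_sub_pow_prime_pow [IsAlgClosed K] [CharZero K] (hp : p.Prime)
    (hpK : ‖(p : K)‖ = (p : ℝ)⁻¹) {μ γ₀ : K} {t a : ℕ} (hta : t ≤ a) (hγ₀ : γ₀ ^ p ^ a = 1)
    (hmin : ∀ γ ∈ GammaR p K, ‖γ₀ - μ‖ ≤ ‖γ - μ‖) :
    ‖γ₀ - μ‖ ^ p ^ t * (p : ℝ)⁻¹ ^ (a - t) ≤ ‖1 - μ ^ p ^ a‖ := by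
  classical
  have hpos : ∀ n, 0 < p ^ n := fun n => pow_pos hp.pos n
  have hγ0 : γ₀ ≠ 0 := fun h => by
    rw [h, zero_pow (hpos a).ne'] at hγ₀
    exact zero_ne_one hγ₀
  have hγn : ‖γ₀‖ = 1 := by
    refine (pow_eq_one_iff_of_nonneg (norm_nonneg γ₀) (hpos a).ne').1 ?_
    rw [← norm_pow, hγ₀, norm_one]
  have hNe : ∀ n, NeZero ((p ^ n : ℕ) : K) := fun n => ⟨by exact_mod_cast (hpos n).ne'⟩
  have := hNe a
  have := hNe t
  obtain ⟨ζ, hζ⟩ := HasEnoughRootsOfUnity.exists_primitiveRoot K (p ^ a)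
  obtain ⟨ξ, hξ⟩ := HasEnoughRootsOfUnity.exists_primitiveRoot K (p ^ t)
  set ν := μ / γ₀ with hν
  have hdist : ∀ γ, ‖ν - γ‖ = ‖γ * γ₀ - μ‖ := fun γ => by
    have h : γ * γ₀ - μ = -((ν - γ) * γ₀) := by rw [hν]; field_simp; ring
    rw [h, norm_neg, norm_mul, hγn, mul_one]
  have hδ : ∀ γ ∈ nthRootsFinset (p ^ a) (1 : K), ‖γ₀ - μ‖ ≤ ‖ν - γ‖ := fun γ hγ => by
    rw [mem_nthRootsFinset (hpos _)] at hγ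
    rw [hdist]
    exact hmin _ ⟨a, by rw [mul_pow, hγ, hγ₀, one_mul]⟩
  have h1 : ∀ γ ∈ nthRootsFinset (p ^ a) (1 : K), ‖1 - γ‖ ≤ ‖ν - γ‖ := fun γ hγ => by
    have := norm_sub_le_max_norm (ν - γ) (ν - 1)
    rw [sub_sub_sub_cancel_left, hdist 1, one_mul] at this
    exact this.trans (max_le le_rfl (hδ γ hγ))
  have hsub : nthRootsFinset (p ^ t) (1 : K) ⊆ nthRootsFinset (p ^ a) (1 : K) := fun γ hγ => by
    rw [mem_nthRootsFinset (hpos _)] at *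
    rw [← Nat.add_sub_cancel' hta, pow_add, pow_mul, hγ, one_pow]
  have hfac : ν ^ p ^ a - 1 = ∏ γ ∈ nthRootsFinset (p ^ a) (1 : K), (ν - γ) := by
    have := congrArg (eval ν) (X_pow_sub_one_eq_prod (hpos a) hζ)
    simpa [eval_prod] using this
  have hμν : μ ^ p ^ a = ν ^ p ^ a := by rw [hν, div_pow, hγ₀, div_one]
  rw [hμν, norm_sub_rev 1, hfac, norm_prod, ← Finset.prod_sdiff hsub, mul_comm]
  gcongr
  · calc (p : ℝ)⁻¹ ^ (a - t)
        = ∏ γ ∈ nthRootsFinset (p ^ a) (1 : K) \ nthRootsFinset (p ^ t) (1 : K), ‖1 - γ‖ := by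
          rw [← norm_prod, prod_one_sub_sdiff_nthRoots hp hta, norm_pow, hpK]
      _ ≤ _ := Finset.prod_le_prod (fun _ _ => norm_nonneg _)
        fun γ hγ => h1 γ (Finset.sdiff_subset hγ)
  · calc ‖γ₀ - μ‖ ^ p ^ t = ∏ _γ ∈ nthRootsFinset (p ^ t) (1 : K), ‖γ₀ - μ‖ := by
          rw [Finset.prod_const, hξ.card_nthRootsFinset]
      _ ≤ _ := Finset.prod_le_prod (fun _ _ => norm_nonneg _) fun γ hγ => hδ γ (hsub hγ)

end SmallDivisors

section ValuationSums

variable {p : ℕ}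

/-- Lower bound for the sum of an antitone function of the `p`-adic valuation. -/
lemma mul_le_sum_padicValNat [Fact p.Prime] {g : ℕ → ℝ} (hg : Antitone g) {M A : ℕ}
    (hMA : M < p ^ A) :
    M * (g 0 + ∑ a ∈ Finset.range A, (g (a + 1) - g a) / (p : ℝ) ^ (a + 1))
      ≤ ∑ j ∈ Finset.Ioc 0 M, g (padicValNat p j) := by
  have hp : p.Prime := Fact.out
  have hexp : ∀ j ∈ Finset.Ioc 0 M, g (padicValNat p j) =
      g 0 + ∑ a ∈ Finset.range A, if p ^ (a + 1) ∣ j then g (a + 1) - g a else 0 := by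
    intro j hj
    obtain ⟨hj0, hjM⟩ := Finset.mem_Ioc.1 hj
    have hv : padicValNat p j < A := (Nat.pow_lt_pow_iff_right hp.one_lt).1
      ((Nat.le_of_dvd hj0 pow_padicValNat_dvd).trans_lt (hjM.trans_lt hMA))
    rw [← Finset.sum_filter]
    have hfil : (Finset.range A).filter (fun a => p ^ (a + 1) ∣ j)
        = Finset.range (padicValNat p j) := by
      ext a
      simp only [Finset.mem_filter, Finset.mem_range, padicValNat_dvd_iff_le hj0.ne']
      omega
    rw [hfil, Finset.sum_range_sub, add_sub_cancel]
  rw [Finset.sum_congr rfl hexp, Finset.sum_add_distrib, Finset.sum_comm]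
  have hcard : ∀ a, ∑ j ∈ Finset.Ioc 0 M, (if p ^ (a + 1) ∣ j then g (a + 1) - g a else 0)
      = ((M / p ^ (a + 1) : ℕ) : ℝ) * (g (a + 1) - g a) := fun a => by
    rw [← Finset.sum_filter, Finset.sum_const, Nat.Ioc_filter_dvd_card_eq_div, nsmul_eq_mul]
  simp only [hcard, Finset.sum_const, Nat.card_Ioc, tsub_zero, nsmul_eq_mul]
  rw [mul_add, Finset.mul_sum]
  refine add_le_add_right (Finset.sum_le_sum fun a _ => ?_) _
  have h1 : ((M / p ^ (a + 1) : ℕ) : ℝ) ≤ (M : ℝ) / (p : ℝ) ^ (a + 1) := by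
    exact_mod_cast Nat.cast_div_le
  have h2 : g (a + 1) - g a ≤ 0 := sub_nonpos.2 (hg (Nat.le_succ a))
  calc (M : ℝ) * ((g (a + 1) - g a) / (p : ℝ) ^ (a + 1))
      = (M : ℝ) / (p : ℝ) ^ (a + 1) * (g (a + 1) - g a) := by ring
    _ ≤ _ := mul_le_mul_of_nonpos_right h1 h2

lemma add_sum_sub_div_pow_eq (hp : p ≠ 0) (g : ℕ → ℝ) (A : ℕ) :
    g 0 + ∑ a ∈ Finset.range A, (g (a + 1) - g a) / (p : ℝ) ^ (a + 1)
      = g A / (p : ℝ) ^ A + ∑ a ∈ Finset.range A, (1 - 1 / (p : ℝ)) * g a / (p : ℝ) ^ a := by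
  have hp' : (p : ℝ) ≠ 0 := by exact_mod_cast hp
  induction A with
  | zero => simp
  | succ A ih =>
    rw [Finset.sum_range_succ, Finset.sum_range_succ, ← add_assoc, ih, pow_succ]
    field_simp
    ring

/-- The exponent `m · log r̃(λ)`, as a function of `x = log |1 - λ ^ m|` and
`y = log |γ₀ - λ ^ m|`. -/
noncomputable def logRadius (p s t : ℕ) (x y : ℝ) : ℝ :=
  -(Real.log p / ((p : ℝ) ^ s * ((p : ℝ) - 1))) - ((s : ℝ) - t) / (p : ℝ) ^ s * Real.log p
    + (s : ℝ) * ((p : ℝ) - 1) / p * x + (p : ℝ) ^ t / (p : ℝ) ^ s * y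

lemma logRadius_neg (hp : 1 < p) {s t : ℕ} (hts : t ≤ s) {x y : ℝ} (hx : x ≤ 0) (hy : y ≤ 0) :
    logRadius p s t x y < 0 := by
  have hp' : (1 : ℝ) < p := by exact_mod_cast hp
  have hp1 : 0 < (p : ℝ) - 1 := by linarith
  have hlog : 0 < Real.log p := Real.log_pos hp'
  have hst : 0 ≤ (s : ℝ) - t := sub_nonneg.2 (by exact_mod_cast hts)
  have h1 : 0 < Real.log p / ((p : ℝ) ^ s * ((p : ℝ) - 1)) := by positivity
  have h2 : 0 ≤ ((s : ℝ) - t) / (p : ℝ) ^ s * Real.log p := by positivity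
  have h3 : (s : ℝ) * ((p : ℝ) - 1) / p * x ≤ 0 := mul_nonpos_of_nonneg_of_nonpos (by positivity) hx
  have h4 : (p : ℝ) ^ t / (p : ℝ) ^ s * y ≤ 0 := mul_nonpos_of_nonneg_of_nonpos (by positivity) hy
  rw [logRadius]
  linarith

lemma logRadius_lt_add_sum (hp : 1 < p) {s t : ℕ} {x y : ℝ} {g : ℕ → ℝ}
    (hlt : ∀ a < s, (p : ℝ) ^ a * x ≤ g a)
    (hge : ∀ a, s ≤ a → (p : ℝ) ^ t * y - ((a : ℝ) - t) * Real.log p ≤ g a) {A : ℕ} (hA : s ≤ A) :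
    logRadius p s t x y
      < g 0 + ∑ a ∈ Finset.range A, (g (a + 1) - g a) / (p : ℝ) ^ (a + 1) := by
  have hp' : (1 : ℝ) < p := by exact_mod_cast hp
  have hp0 : (p : ℝ) ≠ 0 := by positivity
  have hp1 : 0 < (p : ℝ) - 1 := by linarith
  have hlog : 0 < Real.log p := Real.log_pos hp'
  let h : ℕ → ℝ := fun a =>
    if a < s then (p : ℝ) ^ a * x else (p : ℝ) ^ t * y - ((a : ℝ) - t) * Real.log p
  have hhg : ∀ a, h a ≤ g a := fun a => by
    simp only [h]
    split_ifs with ha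
    exacts [hlt a ha, hge a (not_lt.1 ha)]
  have hval : h A / (p : ℝ) ^ A + ∑ a ∈ Finset.range A, (1 - 1 / (p : ℝ)) * h a / (p : ℝ) ^ a
      = logRadius p s t x y + Real.log p / ((p : ℝ) ^ A * ((p : ℝ) - 1)) := by
    induction A, hA using Nat.le_induction with
    | base =>
      have hsum : ∑ a ∈ Finset.range s, (1 - 1 / (p : ℝ)) * h a / (p : ℝ) ^ a
          = s * ((1 - 1 / (p : ℝ)) * x) := by
        rw [Finset.sum_congr rfl (g := fun _ => (1 - 1 / (p : ℝ)) * x), Finset.sum_const,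
          Finset.card_range, nsmul_eq_mul]
        intro a ha
        simp only [h, if_pos (Finset.mem_range.1 ha)]
        field_simp
      rw [hsum, logRadius]
      simp only [h, lt_irrefl, if_false]
      field_simp
      ring
    | succ A hA ih =>
      have hA1 : h (A + 1) = h A - Real.log p := by
        simp only [h, if_neg (not_lt.2 hA), if_neg (not_lt.2 (Nat.le_succ_of_le hA))]
        push_cast
        ring
      rw [Finset.sum_range_succ, hA1]
      have : ∑ a ∈ Finset.range A, (1 - 1 / (p : ℝ)) * h a / (p : ℝ) ^ a = logRadius p s t x y
          + Real.log p / ((p : ℝ) ^ A * ((p : ℝ) - 1)) - h A / (p : ℝ) ^ A := by linarith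
      rw [this, pow_succ]
      field_simp
      ring
  have hpos : 0 < Real.log p / ((p : ℝ) ^ A * ((p : ℝ) - 1)) := by positivity
  have hinv : 0 ≤ 1 - 1 / (p : ℝ) := by
    rw [sub_nonneg, div_le_one (by linarith)]; exact hp'.le
  rw [add_sum_sub_div_pow_eq (by omega)]
  calc logRadius p s t x y < _ := lt_add_of_pos_right _ hpos
    _ = _ := hval.symm
    _ ≤ _ := by
      gcongr
      exacts [hhg A, hhg _]

end ValuationSums

section LinearizationRadius

variable {p : ℕ} {K : Type*} [NontriviallyNormedField K]

lemma rTilde_eq_exp (hp : 1 < p) {lam γ₀ : K} {m s t : ℕ} (hm : m ≠ 0)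
    (hμ : 0 < ‖1 - lam ^ m‖) (hδ : 0 < ‖γ₀ - lam ^ m‖) :
    rTilde p lam γ₀ m s t = Real.exp
      (logRadius p s t (Real.log ‖1 - lam ^ m‖) (Real.log ‖γ₀ - lam ^ m‖) / m) := by
  have hp' : (1 : ℝ) < p := by exact_mod_cast hp
  have hp0 : (0 : ℝ) < p := by linarith
  have hp1 : (p : ℝ) - 1 ≠ 0 := by linarith
  have hm' : (m : ℝ) ≠ 0 := by exact_mod_cast hm
  rw [rTilde, Rr_succ, ← Real.rpow_mul hp0.le, Real.rpow_def_of_pos hp0, Real.rpow_def_of_pos hp0,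
    Real.rpow_def_of_pos hμ, Real.rpow_def_of_pos hδ, Real.rpow_sub hp0, Real.rpow_natCast,
    Real.rpow_natCast, ← Real.exp_add, ← Real.exp_add, ← Real.exp_add, logRadius]
  congr 1
  field_simp
  ring

variable [IsUltrametricDist K]

lemma norm_one_sub_pow_mul_le {x : K} (hx : ‖x‖ ≤ 1) (n k : ℕ) :
    ‖1 - x ^ (n * k)‖ ≤ ‖1 - x ^ n‖ := by
  rcases k with _ | k
  · simp
  have hxn : ‖x ^ n‖ ≤ 1 := by rw [norm_pow]; exact pow_le_one₀ (norm_nonneg x) hx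
  simpa [pow_mul] using norm_pow_succ_sub_pow_succ_le (norm_one (α := K)).le hxn k

lemma norm_one_sub_pow_eq_one_of_not_dvd {lam : K} (hlam : ‖lam‖ = 1) {m : ℕ}
    (hm : IsLeast {n : ℕ | 1 ≤ n ∧ ‖1 - lam ^ n‖ < 1} m) {n : ℕ} (hn : ¬ m ∣ n) :
    ‖1 - lam ^ n‖ = 1 := by
  have hle : ∀ n : ℕ, ‖1 - lam ^ n‖ ≤ 1 := fun n =>
    (norm_sub_le_max_norm 1 _).trans (by simp [hlam])
  refine (hle n).antisymm (le_of_not_gt fun hlt => ?_)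
  have hr : ‖1 - lam ^ (n % m)‖ < 1 := by
    have hdecomp : 1 - lam ^ (n % m)
        = (1 - lam ^ n) - lam ^ (n % m) * (1 - lam ^ (m * (n / m))) := by
      conv_rhs => rw [← Nat.mod_add_div n m]
      rw [Nat.add_mul_mod_self_left, Nat.mod_mod, Nat.add_mul_div_left _ _ hm.1.1,
        Nat.div_eq_of_lt (Nat.mod_lt _ hm.1.1), zero_add, pow_add]
      ring
    rw [hdecomp]
    refine (norm_sub_le_max_norm _ _).trans_lt (max_lt hlt ?_)
    rw [norm_mul, norm_pow, hlam, one_pow, one_mul]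
    exact (norm_one_sub_pow_mul_le hlam.le m _).trans_lt hm.1.2
  have hmod : n % m ≠ 0 := fun h => hn (Nat.dvd_of_mod_eq_zero h)
  exact absurd (hm.2 ⟨Nat.one_le_iff_ne_zero.2 hmod, hr⟩) (Nat.mod_lt _ hm.1.1).not_ge

/-- Lower bound for the products of small divisors. -/
lemma rTilde_pow_lt_prod [Fact p.Prime] [IsAlgClosed K] [CharZero K]
    (hpK : ‖(p : K)‖ = (p : ℝ)⁻¹) (hcop : ∀ u : ℕ, p.Coprime u → ‖(u : K)‖ = 1)
    {lam : K} (hlam : ‖lam‖ = 1) (hroot : ∀ n : ℕ, 1 ≤ n → lam ^ n ≠ 1)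
    {m : ℕ} (hm : IsLeast {n : ℕ | 1 ≤ n ∧ ‖1 - lam ^ n‖ < 1} m)
    {s : ℕ} (hs : Rr p s ≤ ‖1 - lam ^ m‖ ∧ ‖1 - lam ^ m‖ < Rr p (s + 1))
    {γ₀ : K} (hγ₀ : γ₀ ∈ GammaR p K)
    (hγmin : ∀ γ ∈ GammaR p K, ‖γ₀ - lam ^ m‖ ≤ ‖γ - lam ^ m‖)
    {t : ℕ} (ht : Rr p t ≤ ‖γ₀ - lam ^ m‖) :
    0 < rTilde p lam γ₀ m s t ∧ rTilde p lam γ₀ m s t < 1 ∧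
    ∀ N : ℕ, rTilde p lam γ₀ m s t ^ (N + 1)
      < ∏ n ∈ Finset.range (N + 1), ‖1 - lam ^ (n + 1)‖ := by
  have hp : p.Prime := Fact.out
  have hm0 : 0 < m := hm.1.1
  have hnorm_pos : ∀ n, 1 ≤ n → 0 < ‖1 - lam ^ n‖ := fun n hn =>
    norm_pos_iff.2 (sub_ne_zero.2 (hroot n hn).symm)
  have hμ : 0 < ‖1 - lam ^ m‖ := hnorm_pos m hm0
  have hδ : 0 < ‖γ₀ - lam ^ m‖ := norm_pos_iff.2 (sub_ne_zero.2 fun h => by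
    obtain ⟨k, hk⟩ := hγ₀
    rw [h, ← pow_mul] at hk
    exact hroot _ (Nat.mul_pos hm0 (pow_pos hp.pos k)) hk)
  have hδμ : ‖γ₀ - lam ^ m‖ ≤ ‖1 - lam ^ m‖ := hγmin 1 ⟨0, by simp⟩
  have hts : t ≤ s := Nat.lt_succ_iff.1
    ((Rr_strictMono hp.one_lt).lt_iff_lt.1 ((ht.trans hδμ).trans_lt hs.2))
  have hγs : γ₀ ^ p ^ s = 1 := by
    refine pow_eq_one_of_norm_lt_Rr hp hpK s (lt_of_le_of_lt ?_ hs.2) hγ₀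
    have := norm_sub_le_max_norm (1 - lam ^ m) (γ₀ - lam ^ m)
    rw [sub_sub_sub_cancel_right] at this
    exact this.trans (max_le le_rfl hδμ)
  set ρ := logRadius p s t (Real.log ‖1 - lam ^ m‖) (Real.log ‖γ₀ - lam ^ m‖) with hρ
  have hρ_neg : ρ < 0 := logRadius_neg hp.one_lt hts (Real.log_nonpos hμ.le hm.1.2.le)
    (Real.log_nonpos hδ.le (hδμ.trans hm.1.2.le))
  have hm' : (0 : ℝ) < m := by exact_mod_cast hm0
  rw [rTilde_eq_exp hp.one_lt hm0.ne' hμ hδ, ← hρ]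
  refine ⟨Real.exp_pos _, by simpa using div_neg_of_neg_of_pos hρ_neg hm', fun N => ?_⟩
  let g : ℕ → ℝ := fun a => Real.log ‖1 - (lam ^ m) ^ p ^ a‖
  have hg_pos : ∀ a, 0 < ‖1 - (lam ^ m) ^ p ^ a‖ := fun a => by
    rw [← pow_mul]; exact hnorm_pos _ (Nat.mul_pos hm0 (pow_pos hp.pos a))
  have hμ1 : ‖lam ^ m‖ ≤ 1 := by rw [norm_pow, hlam, one_pow]
  have hg : Antitone g := antitone_nat_of_succ_le fun a => by
    refine Real.log_le_log (hg_pos _) ?_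
    rw [pow_succ]
    exact norm_one_sub_pow_mul_le hμ1 _ _
  have hglt : ∀ a < s, (p : ℝ) ^ a * Real.log ‖1 - lam ^ m‖ ≤ g a := fun a ha => by
    simp only [g]
    rw [norm_one_sub_pow_prime_pow_eq hp hpK hm.1.2 a s hs.1 ha, Real.log_pow]
    push_cast
    rfl
  have hgge : ∀ a, s ≤ a → (p : ℝ) ^ t * Real.log ‖γ₀ - lam ^ m‖ - ((a : ℝ) - t) * Real.log p
      ≤ g a := fun a ha => by
    have hγa : γ₀ ^ p ^ a = 1 := by
      rw [← Nat.add_sub_cancel' ha, pow_add, pow_mul, hγs, one_pow]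
    have hta := hts.trans ha
    have hp0 : (0 : ℝ) < p := by exact_mod_cast hp.pos
    have h := Real.log_le_log (by positivity)
      (le_norm_one_sub_pow_prime_pow hp hpK hta hγa hγmin)
    rw [Real.log_mul (by positivity) (by positivity), Real.log_pow, Real.log_pow, Real.log_inv,
      Nat.cast_sub hta] at h
    push_cast at h
    simp only [g]
    linarith
  have hdiv : ∀ j, 0 < j → g (padicValNat p j) ≤ Real.log ‖1 - lam ^ (m * j)‖ := fun j hj => by
    have hdecomp : p ^ padicValNat p j * (j / p ^ padicValNat p j) = j :=
      Nat.mul_div_cancel' pow_padicValNat_dvd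
    have hcopj : p.Coprime (j / p ^ padicValNat p j) := by
      rw [← Nat.factorization_def j hp]
      exact Nat.coprime_ordCompl hp hj.ne'
    refine Real.log_le_log (hg_pos _) ?_
    rw [pow_mul]
    conv_rhs => rw [← hdecomp, pow_mul]
    refine norm_one_sub_le_norm_one_sub_pow hcop ?_ hcopj
    refine lt_of_le_of_lt ?_ hm.1.2
    simpa using norm_one_sub_pow_mul_le hμ1 1 (p ^ padicValNat p j)
  have hsum : ∑ n ∈ Finset.Ioc 0 (N + 1), Real.log ‖1 - lam ^ n‖
      = ∑ j ∈ Finset.Ioc 0 ((N + 1) / m), Real.log ‖1 - lam ^ (m * j)‖ := by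
    rw [← Finset.sum_image (g := fun j => m * j) (f := fun n => Real.log ‖1 - lam ^ n‖)
      fun i _ j _ hij => Nat.eq_of_mul_eq_mul_left hm0 hij]
    symm
    refine Finset.sum_subset (fun n hn => ?_) fun n hn hn' => ?_
    · obtain ⟨j, hj, rfl⟩ := Finset.mem_image.1 hn
      obtain ⟨hj0, hj1⟩ := Finset.mem_Ioc.1 hj
      exact Finset.mem_Ioc.2 ⟨Nat.mul_pos hm0 hj0,
        (Nat.mul_le_mul_left m hj1).trans (Nat.mul_div_le _ _)⟩
    · rw [norm_one_sub_pow_eq_one_of_not_dvd hlam hm, Real.log_one]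
      rintro ⟨j, rfl⟩
      obtain ⟨hj0, hj1⟩ := Finset.mem_Ioc.1 hn
      refine hn' (Finset.mem_image.2 ⟨j, Finset.mem_Ioc.2 ⟨Nat.pos_of_mul_pos_left hj0, ?_⟩, rfl⟩)
      rwa [Nat.le_div_iff_mul_le hm0, mul_comm]
  set M := (N + 1) / m with hM
  have hMN : (M : ℝ) * m ≤ ((N + 1 : ℕ) : ℝ) := by exact_mod_cast Nat.div_mul_le_self (N + 1) m
  have hkey : ((N + 1 : ℕ) : ℝ) * (ρ / m) < ∑ n ∈ Finset.Ioc 0 (N + 1), Real.log ‖1 - lam ^ n‖ := by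
    rw [hsum]
    have hle : ((N + 1 : ℕ) : ℝ) * (ρ / m) ≤ M * ρ := by
      rw [mul_div_assoc', div_le_iff₀ hm']
      nlinarith
    rcases Nat.eq_zero_or_pos M with hM0 | hM0
    · rw [hM0, Finset.Ioc_self, Finset.sum_empty]
      exact mul_neg_of_pos_of_neg (by positivity) (div_neg_of_neg_of_pos hρ_neg hm')
    · have hMA : M < p ^ (s + M) := (Nat.lt_pow_self hp.one_lt).trans_le
        (Nat.pow_le_pow_right hp.pos (Nat.le_add_left M s))
      calc ((N + 1 : ℕ) : ℝ) * (ρ / m) ≤ M * ρ := hle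
        _ < M * _ := mul_lt_mul_of_pos_left
          (logRadius_lt_add_sum hp.one_lt hglt hgge (Nat.le_add_right s M)) (by exact_mod_cast hM0)
        _ ≤ _ := mul_le_sum_padicValNat hg hMA
        _ ≤ _ := Finset.sum_le_sum fun j hj => hdiv j (Finset.mem_Ioc.1 hj).1
  have hprod_pos : 0 < ∏ n ∈ Finset.range (N + 1), ‖1 - lam ^ (n + 1)‖ :=
    Finset.prod_pos fun n _ => hnorm_pos _ (Nat.le_add_left 1 n)
  rw [← Real.exp_nat_mul, ← Real.lt_log_iff_exp_lt hprod_pos,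
    Real.log_prod fun n _ => (hnorm_pos _ (Nat.le_add_left 1 n)).ne']
  refine hkey.trans_eq ?_
  rw [Finset.range_eq_Ico, Finset.sum_Ico_add' (fun n => Real.log ‖1 - lam ^ n‖) 0 (N + 1) 1]
  rfl

end LinearizationRadius

/-- Theorem on the general estimate of linearization disks.
For `f ∈ 𝒢_λ`, the conjugacy `H_f` converges on `D_{r̃(λ)}(0)`, maps it bijectively onto
itself and conjugates `f` to `x ↦ λx` there (so the linearization disk contains
`D_{r̃(λ)}(0)`); and if `H_f` converges on the closed disk of radius `r̃(λ)` then the same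
holds for this closed disk. -/
theorem stmt0 (p : ℕ) [Fact p.Prime]
    {K : Type*} [NontriviallyNormedField K] [IsUltrametricDist K] [CompleteSpace K]
    [IsAlgClosed K] [Algebra ℚ_[p] K]
    (hiso : ∀ x : ℚ_[p], ‖algebraMap ℚ_[p] K x‖ = ‖x‖)
    (hdense : Dense {x : K | IsAlgebraic ℚ_[p] x})
    (lam : K) (hlam : ‖lam‖ = 1) (hroot : ∀ n : ℕ, 1 ≤ n → lam ^ n ≠ 1)
    (m : ℕ) (hm : IsLeast {n : ℕ | 1 ≤ n ∧ ‖1 - lam ^ n‖ < 1} m)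
    (s : ℕ) (hs : Rr p s ≤ ‖1 - lam ^ m‖ ∧ ‖1 - lam ^ m‖ < Rr p (s + 1))
    (γ₀ : K) (hγ₀ : γ₀ ∈ GammaR p K)
    (hγmin : ∀ γ ∈ GammaR p K, ‖γ₀ - lam ^ m‖ ≤ ‖γ - lam ^ m‖)
    (t : ℕ) (ht : Rr p t ≤ ‖γ₀ - lam ^ m‖ ∧ ‖γ₀ - lam ^ m‖ < Rr p (t + 1))
    (c : ℕ → K) (hc0 : c 0 = 0) (hc1 : c 1 = lam) (hc : ∀ i, ‖c i‖ ≤ 1)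
    (b : ℕ → K) (hb : IsConjugacy lam c b) :
    ((∀ x : K, ‖x‖ < rTilde p lam γ₀ m s t → Summable fun k => b k * x ^ k) ∧
      Set.BijOn (pEval b) (Metric.ball (0 : K) (rTilde p lam γ₀ m s t))
        (Metric.ball (0 : K) (rTilde p lam γ₀ m s t)) ∧
      (∀ x ∈ Metric.ball (0 : K) (rTilde p lam γ₀ m s t),
        pEval b (pEval c x) = lam * pEval b x) ∧
      LinearizableOn (pEval c) lam (Metric.ball (0 : K) (rTilde p lam γ₀ m s t))) ∧
    ((∀ x : K, ‖x‖ ≤ rTilde p lam γ₀ m s t → Summable fun k => b k * x ^ k) →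
      Set.BijOn (pEval b) (Metric.closedBall (0 : K) (rTilde p lam γ₀ m s t))
          (Metric.closedBall (0 : K) (rTilde p lam γ₀ m s t)) ∧
        LinearizableOn (pEval c) lam (Metric.closedBall (0 : K) (rTilde p lam γ₀ m s t))) := by
  have hnat : ∀ n : ℕ, ‖(n : K)‖ = ‖(n : ℚ_[p])‖ := fun n => by
    rw [← map_natCast (algebraMap ℚ_[p] K), hiso]
  have : CharZero K := charZero_of_injective_algebraMap (algebraMap ℚ_[p] K).injective
  obtain ⟨hr0, hr1, hprod⟩ := rTilde_pow_lt_prod (by rw [hnat, Padic.norm_p])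
    (fun u hu => by rw [hnat, Padic.norm_natCast_eq_one_iff.2 hu]) hlam hroot hm hs hγ₀ hγmin ht.1
  set r := rTilde p lam γ₀ m s t
  have hcoef : ∀ k, ‖b (k + 2)‖ * r ^ (k + 1) < 1 := fun k => by
    rcases (norm_nonneg (b (k + 2))).eq_or_lt with h | h
    · rw [← h, zero_mul]; exact one_pos
    · exact (mul_lt_mul_of_pos_left (hprod k) h).trans_le
        (norm_conjugacy_coeff_mul_prod_le_one hlam hroot hc0 hc1 hc hb (k + 1))
  have hlt : ∀ x : K, ‖x‖ ≤ r → ∀ k, ‖b (k + 2)‖ * ‖x‖ ^ (k + 1) < 1 := fun x hx k =>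
    lt_of_le_of_lt (by gcongr) (hcoef k)
  have hconj : ∀ x : K, ‖x‖ ≤ r → (Summable fun k => b k * x ^ k) →
      pEval b (pEval c x) = lam * pEval b x := fun x hx hsum =>
    pEval_pEval_of_isConjugacy hc0 hc hb (hx.trans_lt hr1) hsum
  have hf : ∀ x : K, ‖x‖ ≤ r → ‖pEval c x‖ ≤ ‖x‖ := fun x hx =>
    norm_pEval_le hc0 hc (hx.trans hr1.le)
  have hsum : ∀ x : K, ‖x‖ < r → Summable fun k => b k * x ^ k := fun x hx => by
    refine (summable_nat_add_iff 2).1 (Summable.of_norm_bounded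
      (g := fun k => r * (‖x‖ / r) ^ (k + 2))
      (((summable_nat_add_iff 2).2 (summable_geometric_of_lt_one (by positivity)
        ((div_lt_one hr0).2 hx))).mul_left r) fun k => ?_)
    have h := mul_le_mul_of_nonneg_right (hcoef k).le
      (by positivity : 0 ≤ r * (‖x‖ / r) ^ (k + 2))
    rw [one_mul] at h
    refine le_trans (le_of_eq ?_) h
    rw [norm_mul, norm_pow, div_pow]
    field_simp
    ring
  refine ⟨?_, fun hsum' => ?_⟩
  · have hbij : Set.BijOn (pEval b) (Metric.ball (0 : K) r) (Metric.ball (0 : K) r) :=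
      bijOn_pEval hb.1 hb.2.1
        (fun x hx y hy => by rw [mem_ball_zero_iff] at *; exact hy.trans_lt hx)
        (fun x hx => hsum x (mem_ball_zero_iff.1 hx))
        fun x hx => hlt x (mem_ball_zero_iff.1 hx).le
    have hconj' : ∀ x ∈ Metric.ball (0 : K) r, pEval b (pEval c x) = lam * pEval b x :=
      fun x hx => by
        rw [mem_ball_zero_iff] at hx
        exact hconj x hx.le (hsum x hx)
    refine ⟨hsum, hbij, hconj', fun x hx => ?_, b, hb.1, hb.2.1,
      fun x hx => hsum x (mem_ball_zero_iff.1 hx), hbij, hconj'⟩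
    rw [mem_ball_zero_iff] at *
    exact (hf x hx.le).trans_lt hx
  · have hbij : Set.BijOn (pEval b) (Metric.closedBall (0 : K) r) (Metric.closedBall (0 : K) r) :=
      bijOn_pEval hb.1 hb.2.1
        (fun x hx y hy => by rw [mem_closedBall_zero_iff] at *; exact hy.trans hx)
        (fun x hx => hsum' x (mem_closedBall_zero_iff.1 hx))
        fun x hx => hlt x (mem_closedBall_zero_iff.1 hx)
    refine ⟨hbij, fun x hx => ?_, b, hb.1, hb.2.1,
      fun x hx => hsum' x (mem_closedBall_zero_iff.1 hx), hbij, fun x hx => ?_⟩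
    · rw [mem_closedBall_zero_iff] at *
      exact (hf x hx).trans hx
    · rw [mem_closedBall_zero_iff] at hx
      exact hconj x hx (hsum' x hx)
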